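/- Suppose x_0⁽¹⁾ ≠ 0 and the gradient method is run for all k ≥ 0 with steps t_k > 0 satisfying both A(t_k) and W(t_k). If τ > 0, then the sequence (f(x_k))_{k≥0} is bounded below (and hence the iterates converge to a point x̄ with x̄⁽¹⁾ = 0, even though f is unbounded below on ℝⁿ). -/

import Mathlib

/-- The index of the first coordinate of `ℝⁿ` (requires `n ≥ 2`). -/
def firstIdx {n : ℕ} (hn : 2 ≤ n) : Fin n := ⟨0, by omega⟩

/-- The objective function `f(x) = a|x⁽¹⁾| + ∑_{i=2}^n x⁽ⁱ⁾` on `ℝⁿ`. -/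
noncomputable def objF {n : ℕ} (hn : 2 ≤ n) (a : ℝ) (x : EuclideanSpace ℝ (Fin n)) : ℝ :=
  a * |x (firstIdx hn)| + ∑ i ∈ Finset.univ.erase (firstIdx hn), x i

/-- The gradient vector `∇f(x) = (sgn(x⁽¹⁾)·a, 1, …, 1)` of `f` at a point `x`
(meaningful when `x⁽¹⁾ ≠ 0`); here `Real.sign u = 1` if `u > 0` and `-1` if `u < 0`. -/
noncomputable def gradF {n : ℕ} (hn : 2 ≤ n) (a : ℝ) (x : EuclideanSpace ℝ (Fin n)) :
    EuclideanSpace ℝ (Fin n) :=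
  (EuclideanSpace.equiv (Fin n) ℝ).symm
    (fun i => if i = firstIdx hn then Real.sign (x (firstIdx hn)) * a else 1)

/-- The steepest-descent search direction `d = −∇f(x)`. -/
noncomputable def dir {n : ℕ} (hn : 2 ≤ n) (a : ℝ) (x : EuclideanSpace ℝ (Fin n)) :
    EuclideanSpace ℝ (Fin n) := -(gradF hn a x)

/-- The Armijo condition `A(t)`:
`f(x + t·d) ≤ f(x) − c₁·t·(a² + n − 1)` where `d = −∇f(x)`. -/
def armijo {n : ℕ} (hn : 2 ≤ n) (a c₁ : ℝ) (x : EuclideanSpace ℝ (Fin n)) (t : ℝ) : Prop :=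
  objF hn a (x + t • dir hn a x) ≤ objF hn a x - c₁ * t * (a ^ 2 + ((n : ℝ) - 1))

/-- The Wolfe condition `W(t)`: `f` is differentiable at `x + t·d` and
`⟨∇f(x + t·d), d⟩ ≥ −c₂·(a² + n − 1)` where `d = −∇f(x)`. -/
noncomputable def wolfe {n : ℕ} (hn : 2 ≤ n) (a c₂ : ℝ) (x : EuclideanSpace ℝ (Fin n))
    (t : ℝ) : Prop :=
  DifferentiableAt ℝ (objF hn a) (x + t • dir hn a x) ∧
    (inner ℝ (gradient (objF hn a) (x + t • dir hn a x)) (dir hn a x) : ℝ) ≥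
      -c₂ * (a ^ 2 + ((n : ℝ) - 1))

/-- `τ = c₁ + (n − 1)(c₁ − 1)/a²`. -/
noncomputable def tauP (n : ℕ) (a c₁ : ℝ) : ℝ := c₁ + ((n : ℝ) - 1) * (c₁ - 1) / a ^ 2

/-- Sum of the coordinates other than the first. -/
noncomputable def restS {n : ℕ} (hn : 2 ≤ n) (x : EuclideanSpace ℝ (Fin n)) : ℝ :=
  ∑ i ∈ Finset.univ.erase (firstIdx hn), x i

lemma objF_line {n : ℕ} (hn : 2 ≤ n) (a : ℝ) (y v : EuclideanSpace ℝ (Fin n)) (s : ℝ) :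
    objF hn a (y + s • v) = a * |y (firstIdx hn) + s * v (firstIdx hn)|
      + (restS hn y + s * restS hn v) := by
  simp only [objF, restS, PiLp.add_apply, PiLp.smul_apply, smul_eq_mul,
    Finset.sum_add_distrib, Finset.mul_sum]

lemma dir_first {n : ℕ} (hn : 2 ≤ n) (a : ℝ) (x : EuclideanSpace ℝ (Fin n)) :
    dir hn a x (firstIdx hn) = - (Real.sign (x (firstIdx hn)) * a) := by
  simp [dir, gradF]

lemma dir_other {n : ℕ} (hn : 2 ≤ n) (a : ℝ) (x : EuclideanSpace ℝ (Fin n)) (i : Fin n)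
    (hi : i ≠ firstIdx hn) : dir hn a x i = -1 := by
  simp [dir, gradF, hi]

lemma restS_dir {n : ℕ} (hn : 2 ≤ n) (a : ℝ) (x : EuclideanSpace ℝ (Fin n)) :
    restS hn (dir hn a x) = -((n : ℝ) - 1) := by
  unfold restS
  rw [Finset.sum_congr rfl (g := fun _ => (-1 : ℝ))
    (fun i hi => dir_other hn a x i (Finset.ne_of_mem_erase hi))]
  rw [Finset.sum_const, Finset.card_erase_of_mem (Finset.mem_univ _), Finset.card_univ,
    Fintype.card_fin, nsmul_eq_mul, Nat.cast_sub (by omega)]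
  simp

lemma line_deriv {n : ℕ} (hn : 2 ≤ n) (a : ℝ) (y v : EuclideanSpace ℝ (Fin n))
    (h : DifferentiableAt ℝ (objF hn a) y) :
    HasDerivAt (fun s : ℝ => a * |y (firstIdx hn) + s * v (firstIdx hn)|
      + (restS hn y + s * restS hn v)) (inner ℝ (gradient (objF hn a) y) v) 0 := by
  have h1 : HasDerivAt (fun s : ℝ => y + s • v) v 0 := by
    simpa using ((hasDerivAt_id (0 : ℝ)).smul_const v).const_add y
  have h2 : HasFDerivAt (objF hn a) (fderiv ℝ (objF hn a) y) (y + (0 : ℝ) • v) := by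
    simpa using h.hasFDerivAt
  have h3 := h2.comp_hasDerivAt (0 : ℝ) h1
  have h4 : inner ℝ (gradient (objF hn a) y) v = fderiv ℝ (objF hn a) y v := by
    simp [gradient]
  rw [h4]
  have h5 : (objF hn a ∘ fun s : ℝ => y + s • v) = fun s : ℝ =>
      a * |y (firstIdx hn) + s * v (firstIdx hn)| + (restS hn y + s * restS hn v) := by
    funext s
    exact objF_line hn a y v s
  rw [h5] at h3
  exact h3

lemma first_ne {n : ℕ} (hn : 2 ≤ n) (a : ℝ) (ha : 0 < a) (y : EuclideanSpace ℝ (Fin n))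
    (h : DifferentiableAt ℝ (objF hn a) y) : y (firstIdx hn) ≠ 0 := by
  intro h0
  have h1 := (line_deriv hn a y (EuclideanSpace.single (firstIdx hn) 1) h).differentiableAt
  have h2 : restS hn (EuclideanSpace.single (firstIdx hn) (1 : ℝ)) = 0 := by
    unfold restS
    apply Finset.sum_eq_zero
    intro i hi
    simp [Finset.ne_of_mem_erase hi]
  simp only [h0, h2] at h1
  apply not_differentiableAt_abs_zero
  have h3 := (h1.sub_const (restS hn y)).const_mul a⁻¹
  simpa [ha.ne'] using h3

lemma line_inner {n : ℕ} (hn : 2 ≤ n) (a : ℝ) (y v : EuclideanSpace ℝ (Fin n))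
    (h : DifferentiableAt ℝ (objF hn a) y) (h0 : y (firstIdx hn) ≠ 0) :
    inner ℝ (gradient (objF hn a) y) v
      = a * (Real.sign (y (firstIdx hn)) * v (firstIdx hn)) + restS hn v := by
  refine (line_deriv hn a y v h).unique ?_
  have h1 : HasDerivAt (fun s : ℝ => y (firstIdx hn) + s * v (firstIdx hn))
      (v (firstIdx hn)) 0 := by
    simpa using ((hasDerivAt_id (0 : ℝ)).mul_const (v (firstIdx hn))).const_add (y (firstIdx hn))
  have h2 : HasDerivAt (fun s : ℝ => restS hn y + s * restS hn v) (restS hn v) 0 := by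
    simpa using ((hasDerivAt_id (0 : ℝ)).mul_const (restS hn v)).const_add (restS hn y)
  have h3 : HasDerivAt (fun s : ℝ => |s|) (Real.sign (y (firstIdx hn)))
      (y (firstIdx hn) + 0 * v (firstIdx hn)) := by
    rw [zero_mul, add_zero]
    rcases lt_or_gt_of_ne h0 with hh | hh
    · rw [Real.sign_of_neg hh]; exact hasDerivAt_abs_neg hh
    · rw [Real.sign_of_pos hh]; exact hasDerivAt_abs_pos hh
  exact ((h3.comp (0 : ℝ) h1).const_mul a).add h2

/-- One step: sign flip and decrease. -/
lemma one_step {n : ℕ} (hn : 2 ≤ n) (a c₁ c₂ : ℝ) (ha : 0 < a) (hc₂ : c₂ < 1)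
    (x y : EuclideanSpace ℝ (Fin n)) (t : ℝ) (hx : x (firstIdx hn) ≠ 0)
    (hy : y = x + t • dir hn a x)
    (hA : armijo hn a c₁ x t) (hW : wolfe hn a c₂ x t) :
    y (firstIdx hn) ≠ 0 ∧ |x (firstIdx hn)| + |y (firstIdx hn)| = a * t ∧
      a * tauP n a c₁ * t ≤ |x (firstIdx hn)| - |y (firstIdx hn)| := by
  obtain ⟨hd, hi⟩ := hW
  have hA' : objF hn a (x + t • dir hn a x) ≤
    objF hn a x - c₁ * t * (a ^ 2 + ((n : ℝ) - 1)) := hA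
  have hox : objF hn a x = a * |x (firstIdx hn)| + restS hn x := rfl
  have hyf : y (firstIdx hn) = x (firstIdx hn) + t * dir hn a x (firstIdx hn) := by
    rw [hy]; simp
  rw [objF_line, ← hyf, hox, restS_dir] at hA'
  rw [← hy] at hd hi
  have hy0 := first_ne hn a ha y hd
  rw [line_inner hn a y _ hd hy0, restS_dir, dir_first] at hi
  rw [dir_first] at hyf
  have hn' : (2 : ℝ) ≤ n := by exact_mod_cast hn
  have hpos : 0 < a ^ 2 + ((n : ℝ) - 1) := by nlinarith [sq_nonneg a]
  have hc : c₂ * (a ^ 2 + ((n : ℝ) - 1)) < a ^ 2 + ((n : ℝ) - 1) := by nlinarith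
  have hsum : |x (firstIdx hn)| + |y (firstIdx hn)| = a * t := by
    rcases lt_or_gt_of_ne hx with hx1 | hx1 <;> rcases lt_or_gt_of_ne hy0 with hy1 | hy1
    · rw [Real.sign_of_neg hx1, Real.sign_of_neg hy1] at hi
      nlinarith
    · rw [Real.sign_of_neg hx1] at hyf
      rw [abs_of_neg hx1, abs_of_pos hy1]; linarith
    · rw [Real.sign_of_pos hx1] at hyf
      rw [abs_of_pos hx1, abs_of_neg hy1]; linarith
    · rw [Real.sign_of_pos hx1, Real.sign_of_pos hy1] at hi
      nlinarith
  refine ⟨hy0, hsum, ?_⟩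
  have hτ : a ^ 2 * tauP n a c₁ = c₁ * (a ^ 2 + ((n : ℝ) - 1)) - ((n : ℝ) - 1) := by
    unfold tauP
    field_simp
    ring
  have : a * (a * tauP n a c₁ * t) ≤ a * (|x (firstIdx hn)| - |y (firstIdx hn)|) := by
    have : a * (a * tauP n a c₁ * t) = (a ^ 2 * tauP n a c₁) * t := by ring
    rw [this, hτ]
    nlinarith
  exact le_of_mul_le_mul_left this ha

/-- if `τ > 0` then `(f(x_k))` is bounded below; hence the iterates converge
to a point `x̄` with `x̄⁽¹⁾ = 0`, even though `f` is unbounded below on `ℝⁿ`. -/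
theorem stmt6 {n : ℕ} (hn : 2 ≤ n) (a c₁ c₂ : ℝ) (ha : Real.sqrt ((n : ℝ) - 1) ≤ a)
    (hc₁ : 0 < c₁) (hc₁₂ : c₁ < c₂) (hc₂ : c₂ < 1)
    (x : ℕ → EuclideanSpace ℝ (Fin n)) (t : ℕ → ℝ)
    (hx0 : x 0 (firstIdx hn) ≠ 0)
    (hstep : ∀ k, x (k + 1) = x k + t k • dir hn a (x k))
    (ht : ∀ k, 0 < t k)
    (hA : ∀ k, armijo hn a c₁ (x k) (t k))
    (hW : ∀ k, wolfe hn a c₂ (x k) (t k))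
    (hτ : 0 < tauP n a c₁) :
    BddBelow (Set.range fun k => objF hn a (x k)) ∧
      (∃ xbar : EuclideanSpace ℝ (Fin n),
        Filter.Tendsto x Filter.atTop (nhds xbar) ∧ xbar (firstIdx hn) = 0) ∧
      ¬ BddBelow (Set.range (objF hn a)) := by
  have hn' : (2 : ℝ) ≤ n := by exact_mod_cast hn
  have ha0 : 0 < a := lt_of_lt_of_le (Real.sqrt_pos.mpr (by linarith)) ha
  have hne : ∀ k, x k (firstIdx hn) ≠ 0 := by
    intro k
    induction k with
    | zero => exact hx0
    | succ k ih => exact (one_step hn a c₁ c₂ ha0 hc₂ _ _ _ ih (hstep k) (hA k) (hW k)).1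
  have H := fun k =>
    (one_step hn a c₁ c₂ ha0 hc₂ _ _ _ (hne k) (hstep k) (hA k) (hW k)).2
  have hp : 0 < a * tauP n a c₁ := mul_pos ha0 hτ
  have hb : ∀ k, a * tauP n a c₁ * ∑ j ∈ Finset.range k, t j
      ≤ |x 0 (firstIdx hn)| - |x k (firstIdx hn)| := by
    intro k
    induction k with
    | zero => simp
    | succ k ih =>
      rw [Finset.sum_range_succ, mul_add]
      linarith [(H k).2]
  have hbd : ∀ k, ∑ j ∈ Finset.range k, t j ≤ |x 0 (firstIdx hn)| / (a * tauP n a c₁) := by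
    intro k
    rw [le_div_iff₀ hp]
    linarith [hb k, abs_nonneg (x k (firstIdx hn))]
  have hsum : Summable t := summable_of_sum_range_le (fun k => (ht k).le) hbd
  have hother : ∀ i, i ≠ firstIdx hn → ∀ k, x k i = x 0 i - ∑ j ∈ Finset.range k, t j := by
    intro i hi k
    induction k with
    | zero => simp
    | succ k ih =>
      rw [hstep k, Finset.sum_range_succ]
      simp only [PiLp.add_apply, PiLp.smul_apply, smul_eq_mul, dir_other hn a _ i hi, ih]
      ring
  have hlim : Filter.Tendsto (fun k => x k) Filter.atTop
      (nhds ((EuclideanSpace.equiv (Fin n) ℝ).symm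
        (fun i => if i = firstIdx hn then 0 else x 0 i - ∑' j, t j))) := by
    have : Filter.Tendsto (fun k => EuclideanSpace.equiv (Fin n) ℝ (x k)) Filter.atTop
        (nhds (fun i => if i = firstIdx hn then 0 else x 0 i - ∑' j, t j)) := by
      rw [tendsto_pi_nhds]
      intro i
      by_cases hi : i = firstIdx hn
      · subst hi
        simp only [if_true]
        have h0 : Filter.Tendsto (fun k => a * t k) Filter.atTop (nhds 0) := by
          simpa using hsum.tendsto_atTop_zero.const_mul a
        refine squeeze_zero_norm (fun k => ?_) h0
        have := (H k).1
        have h2 := abs_nonneg (x (k + 1) (firstIdx hn))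
        change |x k (firstIdx hn)| ≤ _
        linarith
      · simp only [hi, if_false]
        have := (hsum.hasSum.tendsto_sum_nat).const_sub (x 0 i)
        refine this.congr (fun k => ?_)
        exact (hother i hi k).symm
    have h2 := ((EuclideanSpace.equiv (Fin n) ℝ).symm.continuous.tendsto _).comp this
    refine h2.congr (fun k => ?_)
    simp
  have hcont : Continuous (objF hn a) := by
    unfold objF
    fun_prop
  refine ⟨?_, ⟨_, hlim, by simp⟩, ?_⟩
  · exact ((hcont.tendsto _).comp hlim).bddBelow_range
  · rintro ⟨b, hb'⟩
    have h1 : ∀ s : ℝ, b ≤ a * |(0 : ℝ) + s * 0| + (0 + s * ((n : ℝ) - 1)) := by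
      intro s
      have := hb' ⟨(0 : EuclideanSpace ℝ (Fin n)) + s • (EuclideanSpace.equiv (Fin n) ℝ).symm
        (fun i => if i = firstIdx hn then 0 else 1), rfl⟩
      rw [objF_line] at this
      have h2 : restS hn ((EuclideanSpace.equiv (Fin n) ℝ).symm
        (fun i => if i = firstIdx hn then (0 : ℝ) else 1)) = (n : ℝ) - 1 := by
        have h3 := restS_dir hn a 0
        have h4 : restS hn (dir hn a 0) = - restS hn ((EuclideanSpace.equiv (Fin n) ℝ).symm
            (fun i => if i = firstIdx hn then (0 : ℝ) else 1)) := by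
          unfold restS
          rw [← Finset.sum_neg_distrib]
          refine Finset.sum_congr rfl (fun i hi => ?_)
          have hi' := Finset.ne_of_mem_erase hi
          rw [dir_other hn a 0 i hi']
          simp [hi']
        linarith
      rw [h2] at this
      simpa [restS] using this
    have h2 := h1 (-(|b| + 1))
    simp only [mul_zero, add_zero, abs_zero, zero_add] at h2
    nlinarith [neg_abs_le b, abs_nonneg b]
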